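/- Let G be a δ-hyperbolic group. If a subset A ⊆ G is quasiconvex and A ≈ B for some subset B ⊆ G, then B is also quasiconvex. -/

import Mathlib

open Pointwise

section WordMetric

variable {G : Type*} [Group G]

/-- The word length of `g` with respect to a generating set `S`: the length of a shortest
word in the letters of `S` representing `g`. -/
noncomputable def wordLength (S : Set G) (g : G) : ℕ :=
  sInf {n | ∃ l : List G, (∀ s ∈ l, s ∈ S) ∧ l.prod = g ∧ l.length = n}

/-- The word metric `d(x, y) = |x⁻¹ y|` associated with the generating set `S`,
viewed as a real number. -/
noncomputable def wdist (S : Set G) (x y : G) : ℝ :=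
  (wordLength S (x⁻¹ * y) : ℝ)

/-- The Gromov product `(x|y)_w = ½ (d(x,w) + d(y,w) − d(x,y))`. -/
noncomputable def gromovProd (S : Set G) (x y w : G) : ℝ :=
  (wdist S x w + wdist S y w - wdist S x y) / 2

/-- `z` lies between `x` and `y`: `d(x,z) + d(z,y) = d(x,y)`. -/
def LiesBetween (S : Set G) (x z y : G) : Prop :=
  wdist S x z + wdist S z y = wdist S x y

/-- `G` is `δ`-hyperbolic with respect to the word metric of `S`:
(i) the Gromov products satisfy the `δ`-inequality; (ii) triangles are `δ`-thin;
(iii) triangles are `δ`-slim. -/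
def IsHyperbolicWith (S : Set G) (δ : ℝ) : Prop :=
  (∀ x y z w : G,
      gromovProd S x y w ≥ min (gromovProd S x z w) (gromovProd S y z w) - δ) ∧
  (∀ x y z p q : G, LiesBetween S x p y → LiesBetween S x q z →
      wdist S x p = wdist S x q → wdist S x p ≤ gromovProd S y z x →
      wdist S p q ≤ δ) ∧
  (∀ x y z p : G, LiesBetween S x p y →
      ∃ q : G, (LiesBetween S x q z ∨ LiesBetween S z q y) ∧ wdist S p q ≤ δ)

/-- A subset `Q ⊆ G` is `ε`-quasiconvex: every point between two points of `Q`
is at distance at most `ε` from `Q`. -/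
def IsEpsQuasiconvex (S : Set G) (ε : ℝ) (Q : Set G) : Prop :=
  ∀ x ∈ Q, ∀ y ∈ Q, ∀ z : G, LiesBetween S x z y → ∃ q ∈ Q, wdist S z q ≤ ε

/-- A subset `Q ⊆ G` is quasiconvex if it is `ε`-quasiconvex for some `ε ≥ 0`. -/
def IsQuasiconvex (S : Set G) (Q : Set G) : Prop :=
  ∃ ε : ℝ, 0 ≤ ε ∧ IsEpsQuasiconvex S ε Q

/-- For subsets `B A` of a group `G`, `Prec B A` means `B ⪯ A`: there exist finitely many
elements `x₁, …, xₙ ∈ G` with `B ⊆ A x₁ ∪ ⋯ ∪ A xₙ`. -/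
def Prec (B A : Set G) : Prop :=
  ∃ T : Finset G, B ⊆ A * (T : Set G)

/-- `A ≈ B` : `A ⪯ B` and `B ⪯ A`. -/
def Approx (A B : Set G) : Prop :=
  Prec A B ∧ Prec B A

/-- A subset `A` is quasidense if `G ⪯ A`. -/
def Quasidense (A : Set G) : Prop :=
  Prec (Set.univ : Set G) A

/-- The conjugate subgroup `gHg⁻¹`. -/
def conjSubgroup (g : G) (H : Subgroup G) : Subgroup G :=
  H.map (MulAut.conj g).toMonoidHom

/-- `H^G = {g h g⁻¹ : h ∈ H, g ∈ G}`, the union of all conjugates of `H`. -/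
def conjUnion (H : Subgroup G) : Set G :=
  {x | ∃ g : G, ∃ h ∈ H, x = g * h * g⁻¹}

/-- The quasiconvex product `f₀ G₁ f₁ G₂ ⋯ f_{n−1} G_n f_n` determined by the subgroups
`H 0, …, H (n-1)` and the elements `f 0, …, f n`. -/
def quasiconvexProduct (n : ℕ) (f : Fin (n + 1) → G) (H : Fin n → Subgroup G) : Set G :=
  {x | ∃ g : Fin n → G, (∀ i, g i ∈ H i) ∧
        x = f 0 * (List.ofFn fun i : Fin n => g i * f i.succ).prod}

end WordMetric

section WordMetricLemmas

variable {G : Type*} [Group G] {S : Set G}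

/-- If `S` is symmetric and generates `G`, every element has a word of minimal length. -/
theorem exists_list_length_eq_wordLength (hSsym : ∀ s ∈ S, s⁻¹ ∈ S)
    (hSgen : Subgroup.closure S = ⊤) (g : G) :
    ∃ l : List G, (∀ s ∈ l, s ∈ S) ∧ l.prod = g ∧ l.length = wordLength S g := by
  have hg : g ∈ (Subgroup.closure S).toSubmonoid := hSgen ▸ Subgroup.mem_top g
  rw [Subgroup.closure_toSubmonoid] at hg
  obtain ⟨l, hl, hprod⟩ := Submonoid.exists_list_of_mem_closure hg
  refine Nat.sInf_mem
    (s := {n | ∃ l : List G, (∀ s ∈ l, s ∈ S) ∧ l.prod = g ∧ l.length = n})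
    ⟨l.length, l, fun s hs => ?_, hprod, rfl⟩
  rcases hl s hs with h | h
  · exact h
  · simpa using hSsym _ h

theorem wordLength_le_length {l : List G} (hl : ∀ s ∈ l, s ∈ S) :
    wordLength S l.prod ≤ l.length :=
  Nat.sInf_le ⟨l, hl, rfl, rfl⟩

theorem wordLength_mul_le (hSsym : ∀ s ∈ S, s⁻¹ ∈ S) (hSgen : Subgroup.closure S = ⊤)
    (g h : G) : wordLength S (g * h) ≤ wordLength S g + wordLength S h := by
  obtain ⟨l, hl, rfl, hlen⟩ := exists_list_length_eq_wordLength hSsym hSgen g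
  obtain ⟨m, hm, rfl, hmlen⟩ := exists_list_length_eq_wordLength hSsym hSgen h
  rw [← hlen, ← hmlen, ← List.length_append, ← List.prod_append]
  exact wordLength_le_length fun s hs => (List.mem_append.1 hs).elim (hl s) (hm s)

theorem wordLength_inv_le (hSsym : ∀ s ∈ S, s⁻¹ ∈ S) (hSgen : Subgroup.closure S = ⊤)
    (g : G) : wordLength S g⁻¹ ≤ wordLength S g := by
  obtain ⟨l, hl, rfl, hlen⟩ := exists_list_length_eq_wordLength hSsym hSgen g
  have h := wordLength_le_length (S := S) (l := (l.map (·⁻¹)).reverse) (by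
    intro s hs
    obtain ⟨t, ht, rfl⟩ := List.mem_map.1 (List.mem_reverse.1 hs)
    exact hSsym t (hl t ht))
  rwa [← List.prod_inv_reverse, List.length_reverse, List.length_map, hlen] at h

theorem wdist_nonneg (x y : G) : 0 ≤ wdist S x y :=
  Nat.cast_nonneg _

theorem wdist_comm (hSsym : ∀ s ∈ S, s⁻¹ ∈ S) (hSgen : Subgroup.closure S = ⊤)
    (x y : G) : wdist S x y = wdist S y x := by
  have key (g : G) := wordLength_inv_le hSsym hSgen g
  have hxy := key (x⁻¹ * y)
  have hyx := key (y⁻¹ * x)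
  simp only [mul_inv_rev, inv_inv] at hxy hyx
  exact congrArg Nat.cast (le_antisymm hyx hxy)

theorem wdist_triangle (hSsym : ∀ s ∈ S, s⁻¹ ∈ S) (hSgen : Subgroup.closure S = ⊤)
    (x y z : G) : wdist S x z ≤ wdist S x y + wdist S y z := by
  have h := wordLength_mul_le hSsym hSgen (x⁻¹ * y) (y⁻¹ * z)
  rw [show x⁻¹ * y * (y⁻¹ * z) = x⁻¹ * z by group] at h
  simpa only [wdist, ← Nat.cast_add, Nat.cast_le] using h

/-- If `B ⪯ A`, then `B` lies in a bounded neighbourhood of `A`. -/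
theorem Prec.exists_wdist_le (hSsym : ∀ s ∈ S, s⁻¹ ∈ S) (hSgen : Subgroup.closure S = ⊤)
    {A B : Set G} (h : Prec B A) :
    ∃ M : ℝ, 0 ≤ M ∧ ∀ b ∈ B, ∃ a ∈ A, wdist S b a ≤ M := by
  obtain ⟨T, hT⟩ := h
  refine ⟨∑ t ∈ T, (wordLength S t : ℝ), by positivity, fun b hb => ?_⟩
  obtain ⟨a, ha, t, ht, rfl⟩ := Set.mem_mul.1 (hT hb)
  refine ⟨a, ha, ?_⟩
  rw [wdist_comm hSsym hSgen, wdist, inv_mul_cancel_left]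
  exact Finset.single_le_sum (f := fun t => (wordLength S t : ℝ))
    (fun _ _ => Nat.cast_nonneg _) ht

end WordMetricLemmas

/-- Let `G` be a `δ`-hyperbolic group.  If a subset `A ⊆ G` is quasiconvex and `A ≈ B`
for some subset `B ⊆ G`, then `B` is also quasiconvex. -/
theorem quasiconvex_of_approx {G : Type*} [Group G] (S : Set G) (hSfin : S.Finite)
    (hSsym : ∀ s ∈ S, s⁻¹ ∈ S) (hSgen : Subgroup.closure S = ⊤)
    (δ : ℝ) (hδ : 0 ≤ δ) (hhyp : IsHyperbolicWith S δ)
    (A B : Set G) (hA : IsQuasiconvex S A) (hAB : Approx A B) :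
    IsQuasiconvex S B := by
  obtain ⟨ε, hε, hA⟩ := hA
  obtain ⟨M, hM, hAM⟩ := hAB.1.exists_wdist_le hSsym hSgen
  obtain ⟨N, hN, hBN⟩ := hAB.2.exists_wdist_le hSsym hSgen
  have tri := wdist_triangle hSsym hSgen
  have comm := wdist_comm hSsym hSgen
  refine ⟨2 * δ + ε + M + N, by positivity, fun x hx y hy z hz => ?_⟩
  obtain ⟨a, ha, hxa⟩ := hBN x hx
  obtain ⟨c, hc, hyc⟩ := hBN y hy
  obtain ⟨p, hp | hp, hzp⟩ := hhyp.2.2 x y a z hz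
  · refine ⟨x, hx, ?_⟩
    have hpx : wdist S x p + wdist S p a = wdist S x a := hp
    linarith [tri z p x, comm p x, wdist_nonneg (S := S) p a]
  obtain ⟨q, hq | hq, hpq⟩ := hhyp.2.2 a y c p hp
  · obtain ⟨u, hu, hqu⟩ := hA a ha c hc q hq
    obtain ⟨b, hb, hub⟩ := hAM u hu
    exact ⟨b, hb, by linarith [tri z p b, tri p q b, tri q u b]⟩
  · refine ⟨y, hy, ?_⟩
    have hqy : wdist S c q + wdist S q y = wdist S c y := hq
    linarith [tri z p y, tri p q y, comm c y, wdist_nonneg (S := S) c q]
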